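/- Stochastic ProxSkip convergence: under the assumptions of L-smoothness, μ-strong convexity of f, proper closed convexity of ψ, unbiasedness of stochastic gradients, and expected smoothness with constants A, C, if 0 < γ ≤ 1/A and 0 < p ≤ 1, then E[Ψ_T] ≤ (1 - ζ)^T Ψ_0 + γ²C/ζ, where ζ = min{γμ, p²} and Ψ_t = ‖x_t - x⋆‖² + (γ²/p²)‖h_t - h⋆‖². -/

import Mathlib

open RealInnerProductSpace MeasureTheory ProbabilityTheory
noncomputable section
abbrev Euc (d : ℕ) := EuclideanSpace ℝ (Fin d)

/-- `ψ` is proper, closed (lower semicontinuous) and convex, with values in `ℝ ∪ {+∞}`. -/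
def ProperClosedConvex {d : ℕ} (ψ : Euc d → EReal) : Prop :=
  (∃ x, ψ x ≠ ⊤) ∧ (∀ x, ψ x ≠ ⊥) ∧ LowerSemicontinuous ψ ∧
    ∀ x y : Euc d, ∀ a b : ℝ, 0 ≤ a → 0 ≤ b → a + b = 1 →
      ψ (a • x + b • y) ≤ (a : EReal) * ψ x + (b : EReal) * ψ y

/-- `q = prox_{αψ}(x)`. -/
def IsProxPt {d : ℕ} (ψ : Euc d → EReal) (α : ℝ) (x q : Euc d) : Prop :=
  ∀ y : Euc d, (((1:ℝ)/2 * ‖q - x‖ ^ 2 : ℝ) : EReal) + (α : EReal) * ψ q ≤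
    (((1:ℝ)/2 * ‖y - x‖ ^ 2 : ℝ) : EReal) + (α : EReal) * ψ y

/-- Bregman divergence. -/
def bregman {d : ℕ} (f : Euc d → ℝ) (f' : Euc d → Euc d) (x y : Euc d) : ℝ :=
  f x - f y - ⟪f' y, x - y⟫

/-- A lower linear bound on the increments of a scalar function bounds its derivative. -/
theorem le_of_hasDerivAt_zero {k : ℝ → ℝ} {k' c : ℝ} (hk : HasDerivAt k k' 0)
    (hc : ∀ t, 0 < t → t < 1 → t * c ≤ k t - k 0) : c ≤ k' := by
  refine ge_of_tendsto hk.tendsto_slope_zero_right ?_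
  filter_upwards [Ioo_mem_nhdsGT (zero_lt_one' ℝ)] with t ht
  have := hc t ht.1 ht.2
  rw [zero_add, smul_eq_mul, inv_mul_eq_div, le_div_iff₀ ht.1]
  linarith

theorem strongConvex_gradient_le {d : ℕ} {f : Euc d → ℝ} {x v : Euc d} {μ : ℝ}
    (hf : HasGradientAt f v x)
    (hsc : ConvexOn ℝ Set.univ fun x => f x - μ / 2 * ‖x‖ ^ 2) (y : Euc d) :
    f x + ⟪v, y - x⟫ + μ / 2 * ‖y - x‖ ^ 2 ≤ f y := by
  have hd := (hf.hasFDerivAt.sub ((hasFDerivAt_id x).norm_sq.const_mul (μ / 2))).neg.hasLineDerivAt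
    (y - x)
  have key := le_of_hasDerivAt_zero
    (c := (f x - μ / 2 * ‖x‖ ^ 2) - (f y - μ / 2 * ‖y‖ ^ 2)) hd (by
      intro t ht0 ht1
      have := hsc.2 (Set.mem_univ x) (Set.mem_univ y) (sub_nonneg.2 ht1.le) ht0.le
        (sub_add_cancel 1 t)
      have e : (1 - t) • x + t • y = x + t • (y - x) := by module
      rw [e] at this
      simp only [smul_eq_mul] at this
      simp only [Pi.neg_apply, Pi.sub_apply, id, zero_smul, add_zero]
      linarith)
  simp at key
  have e1 : ‖y - x‖ ^ 2 = ‖y‖ ^ 2 - 2 * ⟪x, y⟫ + ‖x‖ ^ 2 := by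
    rw [norm_sub_sq_real, real_inner_comm]
  rw [e1]
  simp only [inner_sub_right, real_inner_self_eq_norm_sq] at key ⊢
  linarith

/-- First-order optimality for the sum of a differentiable and a convex function. -/
theorem ProperClosedConvex.first_order {d : ℕ} {ψ : Euc d → EReal} (hψ : ProperClosedConvex ψ)
    {β : ℝ} (hβ : 0 < β) {φ : Euc d → ℝ} {φ' : Euc d →L[ℝ] ℝ} {q : Euc d}
    (hφ : HasFDerivAt φ φ' q)
    (hmin : ∀ y, ((φ q : ℝ) : EReal) + (β : EReal) * ψ q ≤ ((φ y : ℝ) : EReal) + β * ψ y) :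
    ψ q ≠ ⊤ ∧ ∀ y, ψ y ≠ ⊤ → β * ((ψ q).toReal - (ψ y).toReal) ≤ φ' (y - q) := by
  obtain ⟨⟨x₀, hx₀⟩, hbot, -, hconv⟩ := hψ
  have hreal : ∀ z, ψ z ≠ ⊤ → ∃ r : ℝ, ψ z = r := fun z hz =>
    ⟨_, (EReal.coe_toReal hz (hbot z)).symm⟩
  have hq : ψ q ≠ ⊤ := by
    intro hq
    obtain ⟨r, hr⟩ := hreal x₀ hx₀
    have h := hmin x₀
    rw [hq, hr, EReal.coe_mul_top_of_pos hβ, EReal.coe_add_top, top_le_iff] at h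
    exact EReal.coe_ne_top (φ x₀ + β * r) (by exact_mod_cast h)
  refine ⟨hq, fun y hy => le_of_hasDerivAt_zero (hφ.hasLineDerivAt (y - q)) ?_⟩
  intro t ht0 ht1
  obtain ⟨a, ha⟩ := hreal q hq
  obtain ⟨b, hb⟩ := hreal y hy
  have hz := hconv q y (1 - t) t (by linarith) ht0.le (by ring)
  rw [show (1 - t) • q + t • y = q + t • (y - q) by module, ha, hb] at hz
  norm_cast at hz
  obtain ⟨r, hr⟩ := hreal _ (ne_top_of_le_ne_top (EReal.coe_ne_top _) hz)
  have hm := hmin (q + t • (y - q))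
  rw [ha, hr] at hm
  rw [hr] at hz
  norm_cast at hm hz
  simp only [zero_smul, add_zero, ha, hb, EReal.toReal_coe]
  have := mul_le_mul_of_nonneg_left hz hβ.le
  linarith

/-- Nonexpansiveness of the proximal step, in terms of a subgradient `-v` of `ψ` at `z`. -/
theorem IsProxPt.norm_sq_add_le {d : ℕ} {ψ : Euc d → EReal} (hψ : ProperClosedConvex ψ)
    {α : ℝ} (hα : 0 < α) {u q z v : Euc d} (hq : IsProxPt ψ α u q) (hz : ψ z ≠ ⊤)
    (hv : ∀ y, ψ y ≠ ⊤ → (ψ z).toReal - (ψ y).toReal ≤ ⟪v, y - z⟫) :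
    ‖q - z‖ ^ 2 + ‖q - u - α • v‖ ^ 2 ≤ ‖u - z + α • v‖ ^ 2 := by
  obtain ⟨hqt, hopt⟩ := hψ.first_order hα
    (((hasFDerivAt_id q).sub_const u).norm_sq.const_mul (1 / 2)) hq
  have h1 := hopt z hz
  have h2 := mul_le_mul_of_nonneg_left (hv q hqt) hα.le
  simp at h1
  have e1 : u - z + α • v = (q - z) - (q - u - α • v) := by abel
  have e2 : ⟪q - z, q - u - α • v⟫ = -⟪q - u, z - q⟫ - α * ⟪v, q - z⟫ := by
    rw [inner_sub_right, inner_smul_right, real_inner_comm, real_inner_comm (q - z) v,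
      ← inner_neg_right, neg_sub]
  rw [e1, norm_sub_sq_real (q - z), e2, inner_sub_left]
  linarith

theorem integral_bool_mul_of_indepFun {Ω β : Type*} [MeasurableSpace Ω] [MeasurableSpace β]
    {P : Measure Ω} {θ : Ω → Bool} {Z : Ω → β} {p : ℝ} (hp : 0 ≤ p)
    (hθ : Measurable θ) (hZ : Measurable Z) (hcoin : P {ω | θ ω = true} = ENNReal.ofReal p)
    (hind : IndepFun θ Z P) {F : β → ℝ} (hF : Measurable F) :
    ∫ ω, (if θ ω then (1 : ℝ) else 0) * F (Z ω) ∂P = p * ∫ ω, F (Z ω) ∂P := by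
  have h := hind.integral_fun_comp_mul_comp (f := fun b => if b then (1 : ℝ) else 0) (g := F)
    hθ.aemeasurable hZ.aemeasurable (measurable_of_countable _).aestronglyMeasurable
    hF.aestronglyMeasurable
  rw [h]
  congr 1
  have hs : MeasurableSet {ω | θ ω = true} := hθ (measurableSet_singleton true)
  have : (fun ω => if θ ω then (1 : ℝ) else 0) = {ω | θ ω = true}.indicator 1 := by
    ext ω
    by_cases hω : θ ω = true <;> simp [hω]
  rw [this, integral_indicator_one hs, measureReal_def, hcoin, ENNReal.toReal_ofReal hp]

theorem integrable_inner_of_memLp_two {Ω E : Type*} [MeasurableSpace Ω] {P : Measure Ω}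
    [NormedAddCommGroup E] [InnerProductSpace ℝ E] {a b : Ω → E} (ha : MemLp a 2 P)
    (hb : MemLp b 2 P) : Integrable (fun ω => ⟪a ω, b ω⟫) P := by
  refine ((ha.integrable_norm_pow two_ne_zero).add (hb.integrable_norm_pow two_ne_zero)).mono'
    (ha.1.inner hb.1) (ae_of_all _ fun ω => ?_)
  have := norm_inner_le_norm (𝕜 := ℝ) (a ω) (b ω)
  simp only [Pi.add_apply]
  nlinarith [sq_nonneg (‖a ω‖ - ‖b ω‖), sq_nonneg (‖a ω‖ + ‖b ω‖)]

theorem integral_inner_of_condExp_ae_eq {Ω E : Type*} {m m0 : MeasurableSpace Ω} {P : Measure Ω}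
    [IsProbabilityMeasure P] [NormedAddCommGroup E] [InnerProductSpace ℝ E] [CompleteSpace E]
    {a g w : Ω → E} (hm : m ≤ m0) (ham : StronglyMeasurable[m] a) (ha : MemLp a 2 P)
    (hg : MemLp g 2 P) (hw : P[g | m] =ᵐ[P] w) :
    Integrable (fun ω => ⟪a ω, w ω⟫) P ∧ ∫ ω, ⟪a ω, g ω⟫ ∂P = ∫ ω, ⟪a ω, w ω⟫ ∂P := by
  have h := condExp_bilin_of_stronglyMeasurable_left (innerSL ℝ (E := E)) ham
    (integrable_inner_of_memLp_two ha hg) (hg.integrable one_le_two)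
  have h' : P[fun ω => ⟪a ω, g ω⟫ | m] =ᵐ[P] fun ω => ⟪a ω, w ω⟫ := by
    filter_upwards [h, hw] with ω h1 h2
    rw [← h2]
    exact h1
  exact ⟨integrable_condExp.congr h', by rw [← integral_congr_ae h', integral_condExp hm]⟩

theorem le_pow_mul_add_div_of_contraction {e : ℕ → ℝ} {ζ K : ℝ} (hζ : 0 < ζ) (hζ1 : ζ ≤ 1)
    (hK : 0 ≤ K) (h : ∀ t, e (t + 1) ≤ (1 - ζ) * e t + K) (T : ℕ) :
    e T ≤ (1 - ζ) ^ T * e 0 + K / ζ := by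
  induction T with
  | zero => simpa using div_nonneg hK hζ.le
  | succ t ih =>
    have := mul_le_mul_of_nonneg_left ih (sub_nonneg.2 hζ1)
    have hK' : ζ * (K / ζ) = K := mul_div_cancel₀ K hζ.ne'
    rw [pow_succ]
    linarith [h t]

/-- Averaging the two outcomes of the coin makes the control variate error contract. -/
theorem coin_average {E : Type*} [NormedAddCommGroup E] [InnerProductSpace ℝ E] (a b e : E)
    {γ p : ℝ} (hp : p ≠ 0) :
    ‖a - γ • (e - b)‖ ^ 2 + γ ^ 2 / p ^ 2 * ‖b‖ ^ 2
        + p * (-2 * (γ / p) * ⟪a - γ • (e - b), b⟫) =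
      ‖a‖ ^ 2 - 2 * γ * ⟪a, e⟫ + γ ^ 2 * ‖e‖ ^ 2
        + (1 - p ^ 2) * (γ ^ 2 / p ^ 2 * ‖b‖ ^ 2) := by
  have h : a - γ • (e - b) = (a - γ • e) + γ • b := by module
  rw [h, norm_add_sq_real, norm_sub_sq_real]
  simp only [inner_add_left, inner_sub_left, inner_smul_left, inner_smul_right, norm_smul,
    real_inner_self_eq_norm_sq, mul_pow, Real.norm_eq_abs, sq_abs, RCLike.conj_to_real]
  field_simp
  ring

/-- Stochastic ProxSkip (SProxSkip) convergence: under unbiasedness and expected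
smoothness of the stochastic gradients, `E[Ψ_T] ≤ (1-ζ)^T Ψ₀ + γ²C/ζ` with
`ζ = min{γμ, p²}`. -/
theorem sproxskip_convergence {d : ℕ}
    {Ω : Type*} [MeasurableSpace Ω] (P : Measure Ω) [IsProbabilityMeasure P]
    (f : Euc d → ℝ) (f' : Euc d → Euc d) (ψ : Euc d → EReal)
    (L μ A C γ p : ℝ) (hL : 0 < L) (hμ : 0 < μ) (hA : L ≤ A) (hC : 0 ≤ C)
    (hgrad : ∀ x, HasGradientAt f (f' x) x)
    (hsmooth : ∀ x y, ‖f' x - f' y‖ ≤ L * ‖x - y‖)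
    (hsc : ConvexOn ℝ Set.univ fun x => f x - μ / 2 * ‖x‖ ^ 2)
    (hψ : ProperClosedConvex ψ)
    (hγ0 : 0 < γ) (hγA : γ ≤ 1 / A) (hp : 0 < p) (hp1 : p ≤ 1)
    (xstar : Euc d)
    (hmin : ∀ y, ((f xstar : ℝ) : EReal) + ψ xstar ≤ ((f y : ℝ) : EReal) + ψ y)
    (prox : Euc d → Euc d) (hprox : ∀ u, IsProxPt ψ (γ / p) u (prox u))
    -- the stochastic processes: iterates, control variates, stochastic gradients, coins
    (x h g : ℕ → Ω → Euc d) (θ : ℕ → Ω → Bool) (x0 h0 : Euc d)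
    (hmeasx : ∀ t, Measurable (x t)) (hmeash : ∀ t, Measurable (h t))
    (hmeasg : ∀ t, Measurable (g t)) (hmeasθ : ∀ t, Measurable (θ t))
    (hx0 : ∀ ω, x 0 ω = x0) (hh0 : ∀ ω, h 0 ω = h0)
    -- dynamics of SProxSkip
    (hdyn : ∀ t ω,
      x (t + 1) ω = (if θ t ω then
          prox (x t ω - γ • (g t ω - h t ω) - (γ / p) • h t ω)
        else x t ω - γ • (g t ω - h t ω)) ∧
      h (t + 1) ω = h t ω + (p / γ) • (x (t + 1) ω - (x t ω - γ • (g t ω - h t ω))))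
    -- the coin `θ t` is Bernoulli(p), independent of the current state and gradient
    (hcoin : ∀ t, P {ω | θ t ω = true} = ENNReal.ofReal p)
    (hindep : ∀ t, IndepFun (θ t) (fun ω => (x t ω, h t ω, g t ω)) P)
    -- unbiasedness: `E[g_t | x_t, h_t] = ∇f(x_t)`
    (hunbiased : ∀ t,
      P[g t | MeasurableSpace.comap (fun ω => (x t ω, h t ω)) inferInstance]
        =ᵐ[P] fun ω => f' (x t ω))
    -- expected smoothness: `E[‖g_t - ∇f(x⋆)‖² | x_t, h_t] ≤ 2A D_f(x_t, x⋆) + C`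
    (hES : ∀ t,
      P[(fun ω => ‖g t ω - f' xstar‖ ^ 2) |
          MeasurableSpace.comap (fun ω => (x t ω, h t ω)) inferInstance]
        ≤ᵐ[P] fun ω => 2 * A * bregman f f' (x t ω) xstar + C)
    -- integrability
    (hint : ∀ t, Integrable (fun ω =>
        ‖x t ω - xstar‖ ^ 2 + γ ^ 2 / p ^ 2 * ‖h t ω - f' xstar‖ ^ 2) P)
    (hgint : ∀ t, Integrable (g t) P)
    (hgsqint : ∀ t, Integrable (fun ω => ‖g t ω - f' xstar‖ ^ 2) P)
    (T : ℕ) :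
    ∫ ω, (‖x T ω - xstar‖ ^ 2 + γ ^ 2 / p ^ 2 * ‖h T ω - f' xstar‖ ^ 2) ∂P
      ≤ (1 - min (γ * μ) (p ^ 2)) ^ T *
          (‖x0 - xstar‖ ^ 2 + γ ^ 2 / p ^ 2 * ‖h0 - f' xstar‖ ^ 2)
        + γ ^ 2 * C / min (γ * μ) (p ^ 2) := by
  have hA0 : 0 < A := hL.trans_le hA
  have hα : 0 < γ / p := div_pos hγ0 hp
  have hγA' : γ * A ≤ 1 := by rwa [le_div_iff₀ hA0] at hγA
  have hζ : 0 < min (γ * μ) (p ^ 2) := lt_min (mul_pos hγ0 hμ) (pow_pos hp 2)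
  obtain ⟨hstar, hsub⟩ := hψ.first_order one_pos (hgrad xstar).hasFDerivAt
    (by simpa only [EReal.coe_one, one_mul] using hmin)
  simp only [one_mul, InnerProductSpace.toDual_apply_apply] at hsub
  have hrec : ∀ t, ∫ ω, (‖x (t + 1) ω - xstar‖ ^ 2
        + γ ^ 2 / p ^ 2 * ‖h (t + 1) ω - f' xstar‖ ^ 2) ∂P
      ≤ (1 - min (γ * μ) (p ^ 2)) * ∫ ω, (‖x t ω - xstar‖ ^ 2
        + γ ^ 2 / p ^ 2 * ‖h t ω - f' xstar‖ ^ 2) ∂P + γ ^ 2 * C := by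
    intro t
    have hm : MeasurableSpace.comap (fun ω => (x t ω, h t ω)) inferInstance
        ≤ ‹MeasurableSpace Ω› := ((hmeasx t).prodMk (hmeash t)).comap_le
    let a : Ω → Euc d := fun ω => x t ω - xstar
    let b : Ω → Euc d := fun ω => h t ω - f' xstar
    let e : Ω → Euc d := fun ω => g t ω - f' xstar
    let w : Ω → Euc d := fun ω => f' (x t ω) - f' xstar
    have hma : Measurable a := (hmeasx t).sub_const _
    have hmb : Measurable b := (hmeash t).sub_const _
    have hme : Measurable e := (hmeasg t).sub_const _
    have hc : 0 < γ ^ 2 / p ^ 2 := by positivity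
    have ha : MemLp a 2 P := (memLp_two_iff_integrable_sq_norm hma.aestronglyMeasurable).2 <|
      (hint t).mono' (by fun_prop) <| ae_of_all _ fun ω => by
        rw [Real.norm_of_nonneg (by positivity)]
        exact le_add_of_nonneg_right (by positivity)
    have hb2 : Integrable (fun ω => γ ^ 2 / p ^ 2 * ‖b ω‖ ^ 2) P :=
      (hint t).mono' (by fun_prop) <| ae_of_all _ fun ω => by
        rw [Real.norm_of_nonneg (by positivity)]
        exact le_add_of_nonneg_left (by positivity)
    have hb : MemLp b 2 P := (memLp_two_iff_integrable_sq_norm hmb.aestronglyMeasurable).2 <|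
      (integrable_const_mul_iff hc.ne'.isUnit _).1 hb2
    have he : MemLp e 2 P := (memLp_two_iff_integrable_sq_norm hme.aestronglyMeasurable).2
      (hgsqint t)
    have hv : MemLp (fun ω => a ω - γ • (e ω - b ω)) 2 P := ha.sub ((he.sub hb).const_smul γ)
    have ha2 := ha.integrable_norm_pow two_ne_zero
    have he2 := he.integrable_norm_pow two_ne_zero
    have hv2 := hv.integrable_norm_pow two_ne_zero
    have hae := integrable_inner_of_memLp_two ha he
    have hvb := (integrable_inner_of_memLp_two hv hb).const_mul (-2 * (γ / p))
    have hpt : ∀ ω, ‖x (t + 1) ω - xstar‖ ^ 2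
          + γ ^ 2 / p ^ 2 * ‖h (t + 1) ω - f' xstar‖ ^ 2
        ≤ (‖a ω - γ • (e ω - b ω)‖ ^ 2 + γ ^ 2 / p ^ 2 * ‖b ω‖ ^ 2)
          + (if θ t ω then (1 : ℝ) else 0)
            * (-2 * (γ / p) * ⟪a ω - γ • (e ω - b ω), b ω⟫) := by
      intro ω
      obtain ⟨h1, h2⟩ := hdyn t ω
      rw [h2]
      have hxhat : x t ω - γ • (g t ω - h t ω) - xstar = a ω - γ • (e ω - b ω) := by
        simp only [a, b, e]
        module
      by_cases hθ : θ t ω = true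
      · simp only [hθ, if_true] at h1
        have hq := (hprox (x t ω - γ • (g t ω - h t ω) - (γ / p) • h t ω)).norm_sq_add_le
          hψ hα hstar hsub
        rw [← h1] at hq
        set q := x (t + 1) ω
        have e1 : h t ω + (p / γ) • (q - (x t ω - γ • (g t ω - h t ω))) - f' xstar
            = (p / γ) • (q - (x t ω - γ • (g t ω - h t ω) - (γ / p) • h t ω)
              - (γ / p) • f' xstar) := by
          have : p / γ * (γ / p) = 1 := by field_simp
          simp only [smul_sub, smul_smul, this, one_smul]
          abel
        have e2 : x t ω - γ • (g t ω - h t ω) - (γ / p) • h t ω - xstar + (γ / p) • f' xstar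
            = (a ω - γ • (e ω - b ω)) - (γ / p) • b ω := by
          rw [← hxhat]
          simp only [b]
          module
        have e3 : γ ^ 2 / p ^ 2 * (p / γ) ^ 2 = 1 := by field_simp
        rw [e2, norm_sub_sq_real (a ω - γ • (e ω - b ω)), inner_smul_right, norm_smul, mul_pow,
          Real.norm_eq_abs, sq_abs, div_pow] at hq
        rw [e1, norm_smul, mul_pow, Real.norm_eq_abs, sq_abs, ← mul_assoc, e3, hθ]
        simp only [if_true]
        linarith
      · simp only [hθ] at h1 ⊢
        simp only [Bool.false_eq_true, if_false] at h1 ⊢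
        rw [h1, hxhat]
        simp [b]
    have hcoin_int := integral_bool_mul_of_indepFun hp.le (hmeasθ t)
      ((hmeasx t).prodMk ((hmeash t).prodMk (hmeasg t))) (hcoin t) (hindep t)
      (F := fun z => -2 * (γ / p) * ⟪(z.1 - xstar) - γ • ((z.2.2 - f' xstar)
        - (z.2.1 - f' xstar)), z.2.1 - f' xstar⟫) (by fun_prop)
    have hθm : Measurable fun ω => if θ t ω then (1 : ℝ) else 0 :=
      (measurable_of_countable fun c : Bool => if c then (1 : ℝ) else 0).comp (hmeasθ t)
    have hθint : Integrable (fun ω => (if θ t ω then (1 : ℝ) else 0)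
        * (-2 * (γ / p) * ⟪a ω - γ • (e ω - b ω), b ω⟫)) P :=
      hvb.bdd_mul (c := 1) hθm.aestronglyMeasurable
        (ae_of_all _ fun ω => by split_ifs <;> simp)
    have hstep : ∫ ω, (‖x (t + 1) ω - xstar‖ ^ 2
          + γ ^ 2 / p ^ 2 * ‖h (t + 1) ω - f' xstar‖ ^ 2) ∂P
        ≤ ∫ ω, (‖a ω‖ ^ 2 - 2 * γ * ⟪a ω, e ω⟫ + γ ^ 2 * ‖e ω‖ ^ 2
          + (1 - p ^ 2) * (γ ^ 2 / p ^ 2 * ‖b ω‖ ^ 2)) ∂P := by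
      have hvb2 : Integrable (fun ω => ‖a ω - γ • (e ω - b ω)‖ ^ 2
          + γ ^ 2 / p ^ 2 * ‖b ω‖ ^ 2) P := hv2.add hb2
      refine (integral_mono (hint (t + 1)) (hvb2.add hθint) hpt).trans_eq ?_
      simp only [← coin_average _ _ _ hp.ne']
      rw [integral_add' hvb2 hθint, integral_add hvb2 (hvb.const_mul p),
        integral_const_mul p]
      exact congrArg _ hcoin_int
    have ham : StronglyMeasurable[
        MeasurableSpace.comap (fun ω => (x t ω, h t ω)) inferInstance] a :=
      ((measurable_fst.comp (comap_measurable _)).sub_const _).stronglyMeasurable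
    have hwe : P[e | MeasurableSpace.comap (fun ω => (x t ω, h t ω)) inferInstance]
        =ᵐ[P] w := by
      have h1 := condExp_sub (hgint t) (integrable_const (f' xstar))
        (MeasurableSpace.comap (fun ω => (x t ω, h t ω)) inferInstance)
      rw [condExp_const hm] at h1
      filter_upwards [h1, hunbiased t] with ω h1 h2
      exact h1.trans (congrArg (· - f' xstar) h2)
    obtain ⟨haw, hinner⟩ := integral_inner_of_condExp_ae_eq hm ham ha he hwe
    have hsq : ∫ ω, γ ^ 2 * ‖e ω‖ ^ 2 ∂P
        ≤ ∫ ω, (2 * γ * ⟪a ω, w ω⟫ - γ * μ * ‖a ω‖ ^ 2 + γ ^ 2 * C) ∂P := by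
      rw [integral_const_mul, ← integral_condExp hm, ← integral_const_mul]
      refine integral_mono_ae (integrable_condExp.const_mul _)
        (((haw.const_mul _).sub (ha2.const_mul _)).add (integrable_const _)) ?_
      filter_upwards [hES t] with ω hω
      have hsc0 := strongConvex_gradient_le (hgrad xstar) hsc (x t ω)
      have hsc1 := strongConvex_gradient_le (hgrad (x t ω)) hsc xstar
      have hD : 0 ≤ bregman f f' (x t ω) xstar := by
        have : 0 ≤ μ / 2 * ‖x t ω - xstar‖ ^ 2 := by positivity
        simp only [bregman]
        linarith
      have hDle : bregman f f' (x t ω) xstar + μ / 2 * ‖a ω‖ ^ 2 ≤ ⟪a ω, w ω⟫ := by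
        rw [← neg_sub (x t ω) xstar, inner_neg_right, norm_neg] at hsc1
        rw [real_inner_comm, inner_sub_left]
        simp only [bregman, a]
        linarith
      have h1 := mul_le_mul_of_nonneg_left hω (sq_nonneg γ)
      have h2 : γ * A * (γ * bregman f f' (x t ω) xstar) ≤ γ * bregman f f' (x t ω) xstar :=
        mul_le_of_le_one_left (by positivity) hγA'
      have h3 := mul_le_mul_of_nonneg_left hDle hγ0.le
      refine h1.trans ?_
      linarith
    refine hstep.trans ?_
    have i1 : Integrable (fun ω => ‖a ω‖ ^ 2 - 2 * γ * ⟪a ω, e ω⟫) P :=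
      ha2.sub (hae.const_mul (2 * γ))
    have i2 := he2.const_mul (γ ^ 2)
    have i3 := hb2.const_mul (1 - p ^ 2)
    have s1 : ∫ ω, (‖a ω‖ ^ 2 - 2 * γ * ⟪a ω, e ω⟫ + γ ^ 2 * ‖e ω‖ ^ 2
          + (1 - p ^ 2) * (γ ^ 2 / p ^ 2 * ‖b ω‖ ^ 2)) ∂P
        = ∫ ω, ‖a ω‖ ^ 2 ∂P - 2 * γ * ∫ ω, ⟪a ω, e ω⟫ ∂P + ∫ ω, γ ^ 2 * ‖e ω‖ ^ 2 ∂P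
          + (1 - p ^ 2) * ∫ ω, γ ^ 2 / p ^ 2 * ‖b ω‖ ^ 2 ∂P := by
      rw [← integral_const_mul (2 * γ), ← integral_const_mul (1 - p ^ 2),
        ← integral_sub ha2 (hae.const_mul _), ← integral_add i1 i2]
      exact integral_add (i1.add i2) i3
    have i4 : Integrable (fun ω => 2 * γ * ⟪a ω, w ω⟫ - γ * μ * ‖a ω‖ ^ 2) P :=
      (haw.const_mul _).sub (ha2.const_mul _)
    have s2 : ∫ ω, (2 * γ * ⟪a ω, w ω⟫ - γ * μ * ‖a ω‖ ^ 2 + γ ^ 2 * C) ∂P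
        = 2 * γ * ∫ ω, ⟪a ω, w ω⟫ ∂P - γ * μ * ∫ ω, ‖a ω‖ ^ 2 ∂P + γ ^ 2 * C := by
      rw [← integral_const_mul, ← integral_const_mul, ← integral_sub (haw.const_mul _)
        (ha2.const_mul _), integral_add i4 (integrable_const _)]
      simp
    have s3 : ∫ ω, (‖x t ω - xstar‖ ^ 2 + γ ^ 2 / p ^ 2 * ‖h t ω - f' xstar‖ ^ 2) ∂P
        = ∫ ω, ‖a ω‖ ^ 2 ∂P + ∫ ω, γ ^ 2 / p ^ 2 * ‖b ω‖ ^ 2 ∂P := integral_add ha2 hb2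
    have n1 : 0 ≤ ∫ ω, ‖a ω‖ ^ 2 ∂P := integral_nonneg fun ω => by positivity
    have n2 : 0 ≤ ∫ ω, γ ^ 2 / p ^ 2 * ‖b ω‖ ^ 2 ∂P := integral_nonneg fun ω => by positivity
    have z1 := mul_le_mul_of_nonneg_right (min_le_left (γ * μ) (p ^ 2)) n1
    have z2 := mul_le_mul_of_nonneg_right (min_le_right (γ * μ) (p ^ 2)) n2
    rw [s1, s3, hinner]
    rw [s2] at hsq
    linarith
  have := le_pow_mul_add_div_of_contraction
    (e := fun t => ∫ ω, (‖x t ω - xstar‖ ^ 2 + γ ^ 2 / p ^ 2 * ‖h t ω - f' xstar‖ ^ 2) ∂P) hζ ((min_le_right _ _).trans (pow_le_one₀ hp.le hp1))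
    (mul_nonneg (sq_nonneg γ) hC) hrec T
  simpa [hx0, hh0] using this
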